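/- arXiv:2501.19345 — 3 statements merged into one kernel-verified Lean document; each statement's English description precedes it below -/
import Mathlib

section
/- The conditional mean of the uncentered estimating function in the censoring setting equals the conditional ATE: E[ S_cens(X,O,Y) | X ] = μ_T(X) − μ_C(X), where S_cens(X,O,Y) = 1[O=1](Y − μ_T(X))/π(1|X) − 1[O=0](Y − ν(X))/(g(0|X)π(0|X)) + g(1|X)·1[O=1](Y − μ_T(X))/(g(0|X)π(1|X)) + μ_T(X) − ν(X)/g(0|X) + g(1|X)μ_T(X)/g(0|X). -/
open MeasureTheory ProbabilityTheory

/-- The uncentered estimating function `S_cens` from the censoring setting. -/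
noncomputable def Scens {Ω 𝒳 : Type*} (X : Ω → 𝒳) (O : Ω → Bool) (Y : Ω → ℝ)
    (μ ν : 𝒳 → ℝ) (π g : Bool → 𝒳 → ℝ) (ω : Ω) : ℝ :=
  (if O ω then Y ω - μ (X ω) else 0) / π true (X ω)
    - (if O ω then 0 else Y ω - ν (X ω)) / (g false (X ω) * π false (X ω))
    + g true (X ω) * (if O ω then Y ω - μ (X ω) else 0) / (g false (X ω) * π true (X ω))
    + μ (X ω) - ν (X ω) / g false (X ω) + g true (X ω) * μ (X ω) / g false (X ω)


lemma CondIndepFun_condExp_mul {Ω : Type*} {m : MeasurableSpace Ω} [mΩ : MeasurableSpace Ω]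
    [StandardBorelSpace Ω] (hm : m ≤ mΩ) (P : Measure Ω) [IsProbabilityMeasure P]
    (U V : Ω → ℝ) (hU : Measurable U) (hV : Measurable V)
    (hUi : Integrable U P) (hVi : Integrable V P) (hUV : Integrable (fun ω => U ω * V ω) P)
    (h : CondIndepFun m hm U V P) :
    P[(fun ω => U ω * V ω) | m] =ᵐ[P] fun ω => (P[U | m]) ω * (P[V | m]) ω := by
  have h1 := (condIndepFun_iff_map_prod_eq_prod_map_map hU hV).1 h
  have h2 := ae_of_ae_trim hm h1
  filter_upwards [h2, condExp_ae_eq_integral_condExpKernel hm hUi,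
    condExp_ae_eq_integral_condExpKernel hm hVi,
    condExp_ae_eq_integral_condExpKernel hm hUV] with ω h2 hu hv huv
  rw [huv, hu, hv]
  have hi : IndepFun U V (condExpKernel P m ω) := by
    rw [indepFun_iff_map_prod_eq_prod_map_map hU.aemeasurable hV.aemeasurable]
    rw [Kernel.map_apply _ (hU.prodMk hV), Kernel.prod_apply, Kernel.map_apply _ hU,
      Kernel.map_apply _ hV] at h2
    exact h2
  exact hi.integral_fun_mul_eq_mul_integral hU.aestronglyMeasurable hV.aestronglyMeasurable

/-- The conditional mean of the uncentered estimating function in the censoring setting equals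
the conditional ATE: `E[S_cens(X,O,Y) | X] = μ_T(X) − μ_C(X)`. -/
theorem censoring_S_conditional_mean
    {Ω 𝒳 : Type*} [MeasurableSpace Ω] [StandardBorelSpace Ω]
    [m𝒳 : MeasurableSpace 𝒳]
    (P : Measure Ω) [IsProbabilityMeasure P]
    (X : Ω → 𝒳) (hX : Measurable X)
    (O D : Ω → Bool) (hO : Measurable O) (hD : Measurable D)
    (Y1 Y0 : Ω → ℝ) (hY1m : Measurable Y1) (hY0m : Measurable Y0)
    (hY1 : Integrable Y1 P) (hY0 : Integrable Y0 P)
    -- unconfoundedness: (Y(1),Y(0)) ⊥ (O,D) | X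
    (hunconf : CondIndepFun (MeasurableSpace.comap X m𝒳) hX.comap_le
      (fun ω => (Y1 ω, Y0 ω)) (fun ω => (O ω, D ω)) P)
    (π : Bool → 𝒳 → ℝ) (g : Bool → 𝒳 → ℝ) (μT μC ν : 𝒳 → ℝ)
    -- π(o|X) = P(O = o | X)
    (hπ : ∀ o : Bool,
      P[(fun ω => if O ω = o then (1:ℝ) else 0) | MeasurableSpace.comap X m𝒳]
      =ᵐ[P] fun ω => π o (X ω))
    -- g(d|X) = P(D = d | X, O = 0): E[1[O=0]·1[D=d]|X] = g(d|X)·π(0|X)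
    (hg : ∀ d : Bool,
      P[(fun ω => (if O ω then (0:ℝ) else 1) * (if D ω = d then (1:ℝ) else 0))
        | MeasurableSpace.comap X m𝒳]
      =ᵐ[P] fun ω => g d (X ω) * π false (X ω))
    -- μ_T(X) = E[Y(1)|X], μ_C(X) = E[Y(0)|X]
    (hμT : P[Y1 | MeasurableSpace.comap X m𝒳] =ᵐ[P] fun ω => μT (X ω))
    (hμC : P[Y0 | MeasurableSpace.comap X m𝒳] =ᵐ[P] fun ω => μC (X ω))
    -- ν(X) = E[Ỹ | X, O = 0]: E[1[O=0]·Ỹ|X] = ν(X)·π(0|X)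
    (hν : P[(fun ω => (if O ω then (0:ℝ) else 1) * (if D ω then Y1 ω else Y0 ω))
        | MeasurableSpace.comap X m𝒳]
      =ᵐ[P] fun ω => ν (X ω) * π false (X ω))
    -- common support
    (c : ℝ) (hc : 0 < c)
    (hπc : ∀ (o : Bool) (x : 𝒳), c < π o x)
    (hgc : ∀ (d : Bool) (x : 𝒳), c < g d x)
    (hSint : Integrable (Scens X O (fun ω => if O ω then Y1 ω else (if D ω then Y1 ω else Y0 ω)) μT ν π g) P) :
    P[Scens X O (fun ω => if O ω then Y1 ω else (if D ω then Y1 ω else Y0 ω)) μT ν π g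
        | MeasurableSpace.comap X m𝒳]
      =ᵐ[P] fun ω => μT (X ω) - μC (X ω) := by
  have hm := hX.comap_le
  have aem : ∀ {f h : Ω → ℝ}, P[f | MeasurableSpace.comap X m𝒳] =ᵐ[P] h → AEStronglyMeasurable[MeasurableSpace.comap X m𝒳] h P :=
    fun {f h} e => ⟨P[f | MeasurableSpace.comap X m𝒳], stronglyMeasurable_condExp, e.symm⟩
  -- factorization
  have key : ∀ (a : ℝ × ℝ → ℝ) (b : Bool × Bool → ℝ), Measurable a →
      Integrable (fun ω => a (Y1 ω, Y0 ω)) P → (∀ x, |b x| ≤ 1) →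
      Integrable (fun ω => b (O ω, D ω) * a (Y1 ω, Y0 ω)) P ∧
      P[(fun ω => b (O ω, D ω) * a (Y1 ω, Y0 ω)) | MeasurableSpace.comap X m𝒳] =ᵐ[P]
        fun ω => (P[fun ω => b (O ω, D ω) | MeasurableSpace.comap X m𝒳]) ω * (P[fun ω => a (Y1 ω, Y0 ω) | MeasurableSpace.comap X m𝒳]) ω := by
    intro a b ha hai hb
    have hbm : Measurable fun ω => b (O ω, D ω) :=
      (measurable_of_countable b).comp (hO.prodMk hD)
    have hbi : Integrable (fun ω => b (O ω, D ω)) P :=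
      Integrable.of_bound hbm.aestronglyMeasurable 1 (Filter.Eventually.of_forall fun ω => hb _)
    have hi : Integrable (fun ω => b (O ω, D ω) * a (Y1 ω, Y0 ω)) P :=
      hai.bdd_mul hbm.aestronglyMeasurable (Filter.Eventually.of_forall fun ω => hb _)
    refine ⟨hi, ?_⟩
    exact CondIndepFun_condExp_mul hm P _ _ hbm (ha.comp (hY1m.prodMk hY0m)) hbi hai hi
      ((hunconf.comp ha (measurable_of_countable b)).symm)
  obtain ⟨i1, e1⟩ := key (fun p => p.1) (fun q => if q.1 = true then 1 else 0) measurable_fst hY1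
    (by intro x; split_ifs <;> simp)
  obtain ⟨i2, e2⟩ := key (fun p => p.1)
    (fun q => (if q.1 then (0:ℝ) else 1) * (if q.2 = true then (1:ℝ) else 0)) measurable_fst hY1
    (by intro x; split_ifs <;> simp)
  obtain ⟨i3, e3⟩ := key (fun p => p.2)
    (fun q => (if q.1 then (0:ℝ) else 1) * (if q.2 = false then (1:ℝ) else 0)) measurable_snd hY0
    (by intro x; split_ifs <;> simp)
  dsimp only at i1 e1 i2 e2 i3 e3
  -- indicators
  have hind : ∀ o : Bool, Measurable fun ω => if O ω = o then (1:ℝ) else 0 := fun o =>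
    (measurable_of_countable fun b : Bool => if b = o then (1:ℝ) else 0).comp hO
  have hindb : ∀ o : Bool, ∀ ω, ‖(if O ω = o then (1:ℝ) else 0)‖ ≤ 1 := by
    intro o ω; split_ifs <;> simp
  have hindi : ∀ o : Bool, Integrable (fun ω => if O ω = o then (1:ℝ) else 0) P := fun o =>
    Integrable.of_bound (hind o).aestronglyMeasurable 1 (Filter.Eventually.of_forall (hindb o))
  -- measurability
  have mπ : ∀ o, AEStronglyMeasurable[MeasurableSpace.comap X m𝒳] (fun ω => π o (X ω)) P := fun o => aem (hπ o)
  have π0 : ∀ o x, π o x ≠ 0 := fun o x => (hc.trans (hπc o x)).ne'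
  have g0 : ∀ o x, g o x ≠ 0 := fun o x => (hc.trans (hgc o x)).ne'
  have minv : ∀ {f : Ω → ℝ}, AEStronglyMeasurable[MeasurableSpace.comap X m𝒳] f P →
      AEStronglyMeasurable[MeasurableSpace.comap X m𝒳] (fun ω => (f ω)⁻¹) P := by
    rintro f ⟨f', hf', e⟩
    refine ⟨fun ω => (f' ω)⁻¹, (hf'.measurable.inv).stronglyMeasurable, ?_⟩
    filter_upwards [e] with ω h
    simp only [h]
  have mmul : ∀ {f h : Ω → ℝ}, AEStronglyMeasurable[MeasurableSpace.comap X m𝒳] f P → AEStronglyMeasurable[MeasurableSpace.comap X m𝒳] h P →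
      AEStronglyMeasurable[MeasurableSpace.comap X m𝒳] (fun ω => f ω * h ω) P := fun a b => a.mul b
  have mg : ∀ d, AEStronglyMeasurable[MeasurableSpace.comap X m𝒳] (fun ω => g d (X ω)) P := by
    intro d
    have := mmul (aem (hg d)) (minv (mπ false))
    refine this.congr (Filter.Eventually.of_forall fun ω => ?_)
    exact mul_inv_cancel_right₀ (π0 _ _) _
  have mν : AEStronglyMeasurable[MeasurableSpace.comap X m𝒳] (fun ω => ν (X ω)) P := by
    have := mmul (aem hν) (minv (mπ false))
    refine this.congr (Filter.Eventually.of_forall fun ω => ?_)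
    exact mul_inv_cancel_right₀ (π0 _ _) _
  have mμ : AEStronglyMeasurable[MeasurableSpace.comap X m𝒳] (fun ω => μT (X ω)) P := aem hμT
  -- bounds
  have bπ : ∀ o ω, ‖(π o (X ω))⁻¹‖ ≤ c⁻¹ := by
    intro o ω
    rw [norm_inv, Real.norm_of_nonneg (hc.trans (hπc _ _)).le]
    exact inv_anti₀ hc (hπc _ _).le
  have bg : ∀ o ω, ‖(g o (X ω))⁻¹‖ ≤ c⁻¹ := by
    intro o ω
    rw [norm_inv, Real.norm_of_nonneg (hc.trans (hgc _ _)).le]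
    exact inv_anti₀ hc (hgc _ _).le
  -- multiplication by bounded functions preserves integrability
  have ibπ : ∀ o {f : Ω → ℝ}, Integrable f P → Integrable (fun ω => (π o (X ω))⁻¹ * f ω) P :=
    fun o f hf => hf.bdd_mul ((minv (mπ o)).mono hm) (Filter.Eventually.of_forall (bπ o))
  have ibg : ∀ o {f : Ω → ℝ}, Integrable f P → Integrable (fun ω => (g o (X ω))⁻¹ * f ω) P :=
    fun o f hf => hf.bdd_mul ((minv (mg o)).mono hm) (Filter.Eventually.of_forall (bg o))
  have iint : ∀ {f h : Ω → ℝ}, P[f | MeasurableSpace.comap X m𝒳] =ᵐ[P] h → Integrable h P :=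
    fun e => integrable_condExp.congr e
  have iμ : Integrable (fun ω => μT (X ω)) P := iint hμT
  have iν : Integrable (fun ω => ν (X ω)) P := by
    refine (ibπ false (iint hν)).congr (Filter.Eventually.of_forall fun ω => ?_)
    have := π0 false (X ω)
    simp only; field_simp
  -- identification of ν
  have eYt : (fun ω => (if O ω then (0:ℝ) else 1) * (if D ω then Y1 ω else Y0 ω)) =
      (fun ω => ((if O ω then (0:ℝ) else 1) * (if D ω = true then (1:ℝ) else 0)) * Y1 ω) +
      (fun ω => ((if O ω then (0:ℝ) else 1) * (if D ω = false then (1:ℝ) else 0)) * Y0 ω) := by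
    funext ω
    simp only [Pi.add_apply]
    cases O ω <;> cases D ω <;> simp
  have iYt : Integrable
      (fun ω => (if O ω then (0:ℝ) else 1) * (if D ω then Y1 ω else Y0 ω)) P := by
    rw [eYt]; exact i2.add i3
  have hνeq : ∀ᵐ ω ∂P, ν (X ω) =
      g true (X ω) * μT (X ω) + g false (X ω) * μC (X ω) := by
    have h := condExp_add i2 i3 (MeasurableSpace.comap X m𝒳)
    rw [← eYt] at h
    filter_upwards [h, hν, e2, e3, hg true, hg false, hμT, hμC] with ω h a e2 e3 b1 b2 b3 b4
    rw [a, Pi.add_apply, e2, e3, b1, b2, b3, b4] at h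
    apply mul_right_cancel₀ (π0 false (X ω))
    rw [h]; ring
  have gbd : ∀ᵐ ω ∂P, ‖g true (X ω)‖ ≤ c⁻¹ := by
    have hle : P[(fun ω => (if O ω then (0:ℝ) else 1) * (if D ω = true then (1:ℝ) else 0)) | MeasurableSpace.comap X m𝒳]
        ≤ᵐ[P] P[(fun _ => (1:ℝ)) | MeasurableSpace.comap X m𝒳] := by
      refine condExp_mono ?_ (integrable_const _) (Filter.Eventually.of_forall fun ω => ?_)
      · refine Integrable.of_bound (C := 1) ?_ (Filter.Eventually.of_forall fun ω => ?_)
        · exact ((measurable_of_countable fun q : Bool × Bool =>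
            (if q.1 then (0:ℝ) else 1) * (if q.2 = true then (1:ℝ) else 0)).comp
            (hO.prodMk hD)).aestronglyMeasurable
        · split_ifs <;> simp
      · simp only; split_ifs <;> simp
    rw [condExp_const hm] at hle
    filter_upwards [hle, hg true] with ω h1 h2
    rw [h2] at h1
    have hp := hπc false (X ω)
    have hgp := hgc true (X ω)
    rw [Real.norm_of_nonneg (hc.trans hgp).le, ← one_div, le_div_iff₀ hc]
    nlinarith
  have ibgt : ∀ {f : Ω → ℝ}, Integrable f P → Integrable (fun ω => g true (X ω) * f ω) P :=
    fun {f} hf => hf.bdd_mul ((mg true).mono hm) gbd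
  -- the two residual terms
  have zero1 : ∀ o, ∀ (W : Ω → ℝ) (ρ : 𝒳 → ℝ), Integrable W P →
      AEStronglyMeasurable[MeasurableSpace.comap X m𝒳] (fun ω => ρ (X ω)) P → Integrable (fun ω => ρ (X ω)) P →
      (P[W | MeasurableSpace.comap X m𝒳] =ᵐ[P] fun ω => ρ (X ω) * π o (X ω)) →
      Integrable (fun ω => W ω - ρ (X ω) * (if O ω = o then (1:ℝ) else 0)) P ∧
      P[(fun ω => W ω - ρ (X ω) * (if O ω = o then (1:ℝ) else 0)) | MeasurableSpace.comap X m𝒳] =ᵐ[P] 0 := by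
    intro o W ρ hW hρ hρi hWe
    have hi : Integrable (fun ω => ρ (X ω) * (if O ω = o then (1:ℝ) else 0)) P :=
      hρi.mul_bdd (c := 1) (hind o).aestronglyMeasurable (Filter.Eventually.of_forall (hindb o))
    refine ⟨hW.sub hi, ?_⟩
    filter_upwards [condExp_sub hW hi (MeasurableSpace.comap X m𝒳), hWe, hπ o,
      condExp_mul_of_aestronglyMeasurable_left hρ hi (hindi o)] with ω a b d e
    refine a.trans ?_
    have e' : (P[(fun ω => ρ (X ω) * (if O ω = o then (1:ℝ) else 0)) | MeasurableSpace.comap X m𝒳]) ω = _ := e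
    rw [Pi.sub_apply, b, e', Pi.mul_apply, d]
    simp
  obtain ⟨iA, zA⟩ := zero1 true _ μT i1 mμ iμ (by
    filter_upwards [e1, hπ true, hμT] with ω a b d
    rw [a, b, d, mul_comm])
  obtain ⟨iB, zB⟩ := zero1 false _ ν iYt mν iν hν
  set A := (fun ω => (if O ω = true then (1:ℝ) else 0) * Y1 ω
    - μT (X ω) * (if O ω = true then (1:ℝ) else 0)) with hA
  set B := (fun ω => (if O ω then (0:ℝ) else 1) * (if D ω then Y1 ω else Y0 ω)
    - ν (X ω) * (if O ω = false then (1:ℝ) else 0)) with hB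
  set a := (fun ω => (π true (X ω))⁻¹ + g true (X ω) * ((g false (X ω))⁻¹ * (π true (X ω))⁻¹))
    with ha
  set b := (fun ω => (g false (X ω))⁻¹ * (π false (X ω))⁻¹) with hb
  set k := (fun ω => μT (X ω) - (g false (X ω))⁻¹ * ν (X ω)
    + g true (X ω) * ((g false (X ω))⁻¹ * μT (X ω))) with hk
  have ma : AEStronglyMeasurable[MeasurableSpace.comap X m𝒳] a P :=
    (minv (mπ true)).add (mmul (mg true) (mmul (minv (mg false)) (minv (mπ true))))
  have mb : AEStronglyMeasurable[MeasurableSpace.comap X m𝒳] b P := mmul (minv (mg false)) (minv (mπ false))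
  have mk : AEStronglyMeasurable[MeasurableSpace.comap X m𝒳] k P :=
    (mμ.sub (mmul (minv (mg false)) mν)).add (mmul (mg true) (mmul (minv (mg false)) mμ))
  have ik : Integrable k P := (iμ.sub (ibg false iν)).add (ibgt (ibg false iμ))
  have iaA : Integrable (a * A) P := by
    refine ((ibπ true iA).add (ibgt (ibg false (ibπ true iA)))).congr
      (Filter.Eventually.of_forall fun ω => ?_)
    simp only [ha, Pi.add_apply, Pi.mul_apply]; ring
  have ibB : Integrable (b * B) P := by
    refine (ibg false (ibπ false iB)).congr (Filter.Eventually.of_forall fun ω => ?_)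
    simp only [hb, Pi.mul_apply]; ring
  have hS : Scens X O (fun ω => if O ω then Y1 ω else (if D ω then Y1 ω else Y0 ω)) μT ν π g
      = a * A - b * B + k := by
    funext ω
    have p1 := π0 true (X ω)
    have p2 := π0 false (X ω)
    have p3 := g0 false (X ω)
    simp only [Scens, ha, hA, hb, hB, hk, Pi.add_apply, Pi.sub_apply, Pi.mul_apply]
    cases O ω <;> cases D ω <;> simp <;> field_simp <;> ring
  rw [hS]
  have ek := condExp_of_aestronglyMeasurable' hm mk ik
  filter_upwards [condExp_add (iaA.sub ibB) ik (MeasurableSpace.comap X m𝒳), condExp_sub iaA ibB (MeasurableSpace.comap X m𝒳),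
    condExp_mul_of_aestronglyMeasurable_left ma iaA iA,
    condExp_mul_of_aestronglyMeasurable_left mb ibB iB, zA, zB, ek, hνeq]
    with ω h1 h2 h3 h4 h5 h6 h7 h8
  have p3 := g0 false (X ω)
  rw [h1, Pi.add_apply, h2, Pi.sub_apply, h3, h4, Pi.mul_apply, Pi.mul_apply, h5, h6, h7]
  simp only [hk, h8, Pi.zero_apply]
  field_simp
  ring
end

section
/- Second-order remainder bound in the censoring setting: for estimated nuisances (μ̂_T, ν̂, π̂) and known g, the bias |E[S_cens(X,O,Y; μ̂_T, ν̂, π̂, g)] − E[S_cens(X,O,Y; μ_T, ν, π, g)]| is bounded by C·( ‖π̂(1|·)−π(1|·)‖₂·‖μ̂_T−μ_T‖₂ + ‖π̂(0|·)−π(0|·)‖₂·‖ν̂−ν‖₂ ) for a constant C depending only on the common-support constant c, where the nuisance estimates are treated as fixed functions (independent of the evaluation sample) and ‖·‖₂ is the L²(P_X) norm. -/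
open MeasureTheory ProbabilityTheory

lemma aux_condExp_mul {Ω : Type*} {m mΩ : MeasurableSpace Ω} [StandardBorelSpace Ω]
    (hm : m ≤ mΩ) {P : Measure Ω} [IsFiniteMeasure P] {f g : Ω → ℝ}
    (h : CondIndepFun m hm f g P) (hf : Measurable f) (hg : Measurable g)
    (hfi : Integrable f P) (hgi : Integrable g P) (hfg : Integrable (fun ω => f ω * g ω) P) :
    P[fun ω => f ω * g ω | m] =ᵐ[P] fun ω => P[f | m] ω * P[g | m] ω := by
  have h1 := ae_of_ae_trim hm ((condIndepFun_iff_map_prod_eq_prod_map_map hf hg).1 h)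
  filter_upwards [h1, condExp_ae_eq_integral_condExpKernel hm hfi,
    condExp_ae_eq_integral_condExpKernel hm hgi,
    condExp_ae_eq_integral_condExpKernel hm hfg] with ω e1 e2 e3 e4
  rw [e2, e3, e4]
  have hind : IndepFun f g (condExpKernel P m ω) := by
    rw [indepFun_iff_map_prod_eq_prod_map_map hf.aemeasurable hg.aemeasurable]
    rw [Kernel.map_apply _ (hf.prodMk hg), Kernel.prod_apply, Kernel.map_apply _ hf,
      Kernel.map_apply _ hg] at e1
    exact e1
  exact hind.integral_fun_mul_eq_mul_integral hf.aestronglyMeasurable hg.aestronglyMeasurable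

lemma aux_pull {Ω : Type*} {m mΩ : MeasurableSpace Ω}
    (hm : m ≤ mΩ) {P : Measure Ω} [IsFiniteMeasure P] {h f f' : Ω → ℝ} {B : ℝ}
    (hh : AEStronglyMeasurable[m] h P) (hB : ∀ ω, |h ω| ≤ B)
    (hf : Integrable f P) (hf' : P[f | m] =ᵐ[P] f') :
    Integrable (fun ω => h ω * f ω) P ∧ Integrable (fun ω => h ω * f' ω) P ∧
    ∫ ω, h ω * f ω ∂P = ∫ ω, h ω * f' ω ∂P := by
  have hi : Integrable f' P := integrable_condExp.congr hf'
  have hB' : ∀ᵐ ω ∂P, ‖h ω‖ ≤ B := Filter.Eventually.of_forall hB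
  refine ⟨hf.bdd_mul (hh.mono hm) hB', hi.bdd_mul (hh.mono hm) hB', ?_⟩
  have e := condExp_stronglyMeasurable_mul_of_bound₀ hm hh hf B hB'
  have : ∫ ω, (h * f) ω ∂P = ∫ ω, P[h * f | m] ω ∂P := (integral_condExp hm).symm
  calc _ = ∫ ω, P[h * f | m] ω ∂P := this
    _ = _ := integral_congr_ae (by
      filter_upwards [e, hf'] with ω e1 e2
      rw [e1, Pi.mul_apply, e2])

lemma aux_aipw {Ω : Type*} {m mΩ : MeasurableSpace Ω}
    (hm : m ≤ mΩ) {P : Measure Ω} [IsFiniteMeasure P] {h Z i p n a : Ω → ℝ} {B : ℝ}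
    (hh : AEStronglyMeasurable[m] h P) (hB : ∀ ω, |h ω| ≤ B)
    (hZ : Integrable Z P) (hi : Integrable i P) (hi1 : ∀ ω, |i ω| ≤ 1)
    (ha : AEStronglyMeasurable[m] a P) (hai : Integrable a P)
    (hip : P[i | m] =ᵐ[P] p) (hZp : P[Z | m] =ᵐ[P] fun ω => n ω * p ω) :
    Integrable (fun ω => h ω * (Z ω - a ω * i ω)) P ∧
    Integrable (fun ω => h ω * (p ω * (n ω - a ω))) P ∧
    ∫ ω, h ω * (Z ω - a ω * i ω) ∂P = ∫ ω, h ω * (p ω * (n ω - a ω)) ∂P := by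
  have hia : Integrable (a * i) P :=
    hai.mul_bdd (c := 1) hi.1 (Filter.Eventually.of_forall hi1)
  have e := condExp_mul_of_aestronglyMeasurable_left ha hia hi
  have e2 := condExp_sub hZ hia m
  refine aux_pull hm hh hB (hZ.sub hia) ?_
  filter_upwards [e, e2, hip, hZp] with ω h1 h2 h3 h4
  change P[Z - a * i | m] ω = _
  rw [h2, Pi.sub_apply, h1, Pi.mul_apply, h3, h4]; ring

lemma aux_cs {Ω : Type*} {mΩ : MeasurableSpace Ω}
    {P : Measure Ω} [IsFiniteMeasure P] {k u v : Ω → ℝ} {B : ℝ}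
    (hk : ∀ ω, |k ω| ≤ B) (hB : 0 ≤ B)
    (hu : AEStronglyMeasurable u P) (hv : AEStronglyMeasurable v P)
    (hu2 : Integrable (fun ω => u ω ^ 2) P) (hv2 : Integrable (fun ω => v ω ^ 2) P) :
    |∫ ω, k ω * (u ω * v ω) ∂P| ≤
      B * (Real.sqrt (∫ ω, u ω ^ 2 ∂P) * Real.sqrt (∫ ω, v ω ^ 2 ∂P)) := by
  have mu : MemLp u 2 P := (memLp_two_iff_integrable_sq hu).2 hu2
  have mv : MemLp v 2 P := (memLp_two_iff_integrable_sq hv).2 hv2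
  have huv : Integrable (fun ω => u ω * v ω) P := mu.integrable_mul mv
  have hcs := integral_mul_norm_le_Lp_mul_Lq (μ := P) (f := u) (g := v) (p := 2) (q := 2)
    Real.HolderConjugate.two_two (by simpa using mu) (by simpa using mv)
  have h3 : ∫ ω, ‖u ω‖ * ‖v ω‖ ∂P ≤
      Real.sqrt (∫ ω, u ω ^ 2 ∂P) * Real.sqrt (∫ ω, v ω ^ 2 ∂P) := by
    simpa [Real.sqrt_eq_rpow] using hcs
  calc |∫ ω, k ω * (u ω * v ω) ∂P| ≤ ∫ ω, B * (‖u ω‖ * ‖v ω‖) ∂P := by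
        rw [← Real.norm_eq_abs]
        refine norm_integral_le_of_norm_le ?_ (Filter.Eventually.of_forall fun ω => ?_)
        · refine (huv.norm.congr ?_).const_mul B
          exact Filter.Eventually.of_forall fun ω => norm_mul _ _
        · rw [norm_mul, norm_mul]
          exact mul_le_mul_of_nonneg_right (hk ω) (by positivity)
    _ = B * ∫ ω, ‖u ω‖ * ‖v ω‖ ∂P := integral_const_mul _ _
    _ ≤ _ := mul_le_mul_of_nonneg_left h3 hB

lemma aux_four {Ω : Type*} {mΩ : MeasurableSpace Ω} {P : Measure Ω} {a b c d : Ω → ℝ}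
    (ha : Integrable a P) (hb : Integrable b P) (hc : Integrable c P) (hd : Integrable d P) :
    ∫ ω, (a ω - b ω + c ω - d ω) ∂P
      = ∫ ω, a ω ∂P - ∫ ω, b ω ∂P + ∫ ω, c ω ∂P - ∫ ω, d ω ∂P := by
  have h1 : Integrable (fun ω => a ω - b ω) P := ha.sub hb
  have h2 : Integrable (fun ω => a ω - b ω + c ω) P := h1.add hc
  rw [integral_sub h2 hd, integral_add h1 hc, integral_sub ha hb]

/-- Second-order remainder bound in the censoring setting: for a constant `C` depending only on
the common-support constant `c`, the bias of the estimating function with estimated nuisances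
`(μ̂_T, ν̂, π̂)` and known `g` is bounded by
`C·(‖π̂(1|·)−π(1|·)‖₂‖μ̂_T−μ_T‖₂ + ‖π̂(0|·)−π(0|·)‖₂‖ν̂−ν‖₂)` in `L²(P_X)`. -/
theorem censoring_second_order_remainder :
    ∀ c : ℝ, 0 < c →
    ∃ C : ℝ, 0 < C ∧
    ∀ (Ω 𝒳 : Type) (_ : MeasurableSpace Ω) [StandardBorelSpace Ω]
      (m𝒳 : MeasurableSpace 𝒳)
      (P : Measure Ω) (_ : IsProbabilityMeasure P)
      (X : Ω → 𝒳) (hX : Measurable X)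
      (O D : Ω → Bool), Measurable O → Measurable D →
    ∀ (Y1 Y0 : Ω → ℝ), Measurable Y1 → Measurable Y0 →
      Integrable Y1 P → Integrable Y0 P →
    -- unconfoundedness: (Y(1),Y(0)) ⊥ (O,D) | X
    ∀ (_ : CondIndepFun (MeasurableSpace.comap X m𝒳) hX.comap_le
        (fun ω => (Y1 ω, Y0 ω)) (fun ω => (O ω, D ω)) P)
      (π : Bool → 𝒳 → ℝ) (g : Bool → 𝒳 → ℝ) (μT ν : 𝒳 → ℝ),
    -- π(o|X) = P(O = o | X)
    (∀ o : Bool,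
      P[(fun ω => if O ω = o then (1:ℝ) else 0) | MeasurableSpace.comap X m𝒳]
      =ᵐ[P] fun ω => π o (X ω)) →
    -- g(d|X) = P(D = d | X, O = 0)
    (∀ d : Bool,
      P[(fun ω => (if O ω then (0:ℝ) else 1) * (if D ω = d then (1:ℝ) else 0))
        | MeasurableSpace.comap X m𝒳]
      =ᵐ[P] fun ω => g d (X ω) * π false (X ω)) →
    -- μ_T(X) = E[Y(1)|X]
    (P[Y1 | MeasurableSpace.comap X m𝒳] =ᵐ[P] fun ω => μT (X ω)) →
    -- ν(X) = E[Ỹ | X, O = 0]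
    (P[(fun ω => (if O ω then (0:ℝ) else 1) * (if D ω then Y1 ω else Y0 ω))
        | MeasurableSpace.comap X m𝒳]
      =ᵐ[P] fun ω => ν (X ω) * π false (X ω)) →
    -- common support for the true nuisances
    (∀ (o : Bool) (x : 𝒳), π o x ∈ Set.Ioo c (1 - c)) →
    (∀ (d : Bool) (x : 𝒳), g d x ∈ Set.Ioo c (1 - c)) →
    -- estimated nuisances, treated as fixed functions, with the same bounds on π̂
    ∀ (μhat νhat : 𝒳 → ℝ) (πhat : Bool → 𝒳 → ℝ),
    Measurable μhat → Measurable νhat → (∀ d, Measurable (πhat d)) →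
    (∀ (o : Bool) (x : 𝒳), πhat o x ∈ Set.Ioo c (1 - c)) →
    -- integrability of both estimating functions
    Integrable (Scens X O (fun ω => if O ω then Y1 ω else (if D ω then Y1 ω else Y0 ω))
      μhat νhat πhat g) P →
    Integrable (Scens X O (fun ω => if O ω then Y1 ω else (if D ω then Y1 ω else Y0 ω))
      μT ν π g) P →
    -- L² distances between nuisances finite
    Integrable (fun ω => (μhat (X ω) - μT (X ω))^2) P →
    Integrable (fun ω => (νhat (X ω) - ν (X ω))^2) P →
    |(∫ ω, Scens X O (fun ω' => if O ω' then Y1 ω' else (if D ω' then Y1 ω' else Y0 ω'))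
          μhat νhat πhat g ω ∂P)
      - ∫ ω, Scens X O (fun ω' => if O ω' then Y1 ω' else (if D ω' then Y1 ω' else Y0 ω'))
          μT ν π g ω ∂P|
    ≤ C * (Real.sqrt (∫ ω, (πhat true (X ω) - π true (X ω))^2 ∂P)
            * Real.sqrt (∫ ω, (μhat (X ω) - μT (X ω))^2 ∂P)
         + Real.sqrt (∫ ω, (πhat false (X ω) - π false (X ω))^2 ∂P)
            * Real.sqrt (∫ ω, (νhat (X ω) - ν (X ω))^2 ∂P)) := by
  intro c hc
  refine ⟨(1 + 1 / c) / c + 1 / c ^ 2, by positivity, ?_⟩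
  intro Ω 𝒳 mΩ _ m𝒳 P hP X hX O D hO hD Y1 Y0 hY1 hY0 hY1i hY0i hci π g μT ν hπ hg hμT hν
    hπb hgb μhat νhat πhat hμhat hνhat hπhat hπhatb hS1 hS2 hL1 hL2
  have hm : MeasurableSpace.comap X m𝒳 ≤ mΩ := hX.comap_le
  have hcX : Measurable[MeasurableSpace.comap X m𝒳] X := comap_measurable X
  have meas : ∀ f : 𝒳 → ℝ, Measurable f →
      AEStronglyMeasurable[MeasurableSpace.comap X m𝒳] (fun ω => f (X ω)) P := fun f hf =>
    (hf.comp hcX).stronglyMeasurable.aestronglyMeasurable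
  have mπ : ∀ o, AEStronglyMeasurable[MeasurableSpace.comap X m𝒳] (fun ω => π o (X ω)) P :=
    fun o => stronglyMeasurable_condExp.aestronglyMeasurable.congr (hπ o)
  have mgπ : ∀ o, AEStronglyMeasurable[MeasurableSpace.comap X m𝒳]
      (fun ω => g o (X ω) * π false (X ω)) P :=
    fun o => stronglyMeasurable_condExp.aestronglyMeasurable.congr (hg o)
  have mμ : AEStronglyMeasurable[MeasurableSpace.comap X m𝒳] (fun ω => μT (X ω)) P :=
    stronglyMeasurable_condExp.aestronglyMeasurable.congr hμT
  have mνπ : AEStronglyMeasurable[MeasurableSpace.comap X m𝒳]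
      (fun ω => ν (X ω) * π false (X ω)) P :=
    stronglyMeasurable_condExp.aestronglyMeasurable.congr hν
  have pπ : ∀ o x, 0 < π o x := fun o x => hc.trans (hπb o x).1
  have pg : ∀ o x, 0 < g o x := fun o x => hc.trans (hgb o x).1
  have pπh : ∀ o x, 0 < πhat o x := fun o x => hc.trans (hπhatb o x).1
  have mg : ∀ o, AEStronglyMeasurable[MeasurableSpace.comap X m𝒳] (fun ω => g o (X ω)) P := by
    intro o
    refine ((mgπ o).div₀ (mπ false)).congr (Filter.Eventually.of_forall fun ω => ?_)
    have := (pπ false (X ω)).ne'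
    simp only [Pi.div_apply]
    field_simp
  have mν : AEStronglyMeasurable[MeasurableSpace.comap X m𝒳] (fun ω => ν (X ω)) P := by
    refine (mνπ.div₀ (mπ false)).congr (Filter.Eventually.of_forall fun ω => ?_)
    have := (pπ false (X ω)).ne'
    simp only [Pi.div_apply]
    field_simp
  have iμ : Integrable (fun ω => μT (X ω)) P := integrable_condExp.congr hμT
  have binv : ∀ t : ℝ, c < t → |t⁻¹| ≤ 1 / c := by
    intro t ht
    rw [abs_of_pos (inv_pos.2 (hc.trans ht)), one_div]
    exact inv_anti₀ hc ht.le
  have iν : Integrable (fun ω => ν (X ω)) P := by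
    have h1 : Integrable (fun ω => ν (X ω) * π false (X ω)) P := integrable_condExp.congr hν
    refine (h1.mul_bdd (g := fun ω => (π false (X ω))⁻¹) (c := 1 / c) ((mπ false).mono hm).inv₀
      (Filter.Eventually.of_forall fun ω => binv _ (hπb false (X ω)).1)).congr
      (Filter.Eventually.of_forall fun ω => ?_)
    have := (pπ false (X ω)).ne'
    simp only
    field_simp
  have iofsq : ∀ u v : Ω → ℝ, AEStronglyMeasurable u P → Integrable v P →
      Integrable (fun ω => (u ω - v ω) ^ 2) P → Integrable u P := by
    intro u v hu hv h
    have h2 : MemLp (fun ω => u ω - v ω) 2 P :=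
      (memLp_two_iff_integrable_sq (hu.sub hv.1)).2 h
    have h3 := (h2.integrable one_le_two).add hv
    exact h3.congr (Filter.Eventually.of_forall fun ω => by simp)
  have iμh : Integrable (fun ω => μhat (X ω)) P :=
    iofsq _ _ ((meas _ hμhat).mono hm) iμ hL1
  have iνh : Integrable (fun ω => νhat (X ω)) P :=
    iofsq _ _ ((meas _ hνhat).mono hm) iν hL2
  -- indicators
  have ii : ∀ o : Bool, Integrable (fun ω => if O ω = o then (1:ℝ) else 0) P := by
    intro o
    refine Integrable.of_bound (C := 1) (Measurable.aestronglyMeasurable ?_)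
      (Filter.Eventually.of_forall fun ω => ?_)
    · exact Measurable.ite (hO (measurableSet_singleton o)) measurable_const measurable_const
    · split_ifs <;> simp
  have ib : ∀ (o : Bool) (ω : Ω), |(if O ω = o then (1:ℝ) else 0)| ≤ 1 := by
    intro o ω; split_ifs <;> simp
  have iOY : Integrable (fun ω => Y1 ω * if O ω = true then (1:ℝ) else 0) P :=
    hY1i.mul_bdd (c := 1) (ii true).1 (Filter.Eventually.of_forall (ib true))
  have mt : Measurable (fun q : Bool × Bool => if q.1 = true then (1:ℝ) else 0) :=
    measurable_of_finite _
  have ci : CondIndepFun (MeasurableSpace.comap X m𝒳) hm Y1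
      (fun ω => if O ω = true then (1:ℝ) else 0) P :=
    hci.comp (φ := Prod.fst) (ψ := fun q : Bool × Bool => if q.1 = true then (1:ℝ) else 0)
      measurable_fst mt
  have hZ1 : P[fun ω => Y1 ω * (if O ω = true then (1:ℝ) else 0) | MeasurableSpace.comap X m𝒳]
      =ᵐ[P] fun ω => μT (X ω) * π true (X ω) := by
    have h1 := aux_condExp_mul hm ci hY1 (mt.comp (hO.prodMk hD)) hY1i (ii true) iOY
    filter_upwards [h1, hμT, hπ true] with ω e1 e2 e3
    rw [e1, e2, e3]
  have iYt : Integrable (fun ω => (if O ω then (0:ℝ) else 1) * (if D ω then Y1 ω else Y0 ω)) P := by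
    refine (hY1i.norm.add hY0i.norm).mono' (Measurable.aestronglyMeasurable ?_)
      (Filter.Eventually.of_forall fun ω => ?_)
    · exact (Measurable.ite (hO (measurableSet_singleton true)) measurable_const
        measurable_const).mul (Measurable.ite (hD (measurableSet_singleton true)) hY1 hY0)
    · have := norm_nonneg (Y1 ω)
      have := norm_nonneg (Y0 ω)
      simp only [Pi.add_apply]
      split_ifs <;> simp <;> positivity
  -- weights
  have mW : AEStronglyMeasurable[MeasurableSpace.comap X m𝒳]
      (fun ω => 1 + g true (X ω) * (g false (X ω))⁻¹) P :=
    aestronglyMeasurable_const.add ((mg true).mul (mg false).inv₀)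
  have mV : AEStronglyMeasurable[MeasurableSpace.comap X m𝒳] (fun ω => (g false (X ω))⁻¹) P :=
    (mg false).inv₀
  have bV : ∀ x, |(g false x)⁻¹| ≤ 1 / c := fun x => binv _ (hgb false x).1
  have bW : ∀ x, |1 + g true x * (g false x)⁻¹| ≤ 1 + 1 / c := by
    intro x
    refine (abs_add_le _ _).trans ?_
    rw [abs_one, abs_mul]
    have h1 : |g true x| ≤ 1 := by
      rw [abs_of_pos (pg true x)]; linarith [(hgb true x).2]
    have := mul_le_mul h1 (bV x) (abs_nonneg _) zero_le_one
    linarith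
  have core : ∀ (μ' ν' : 𝒳 → ℝ) (π' : Bool → 𝒳 → ℝ),
      AEStronglyMeasurable[MeasurableSpace.comap X m𝒳] (fun ω => μ' (X ω)) P →
      AEStronglyMeasurable[MeasurableSpace.comap X m𝒳] (fun ω => ν' (X ω)) P →
      (∀ o, AEStronglyMeasurable[MeasurableSpace.comap X m𝒳] (fun ω => π' o (X ω)) P) →
      Integrable (fun ω => μ' (X ω)) P → Integrable (fun ω => ν' (X ω)) P →
      (∀ o x, c < π' o x) →
      Integrable (fun ω => (1 + g true (X ω) * (g false (X ω))⁻¹) * (π' true (X ω))⁻¹ *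
          (π true (X ω) * (μT (X ω) - μ' (X ω)))
        - (g false (X ω))⁻¹ * (π' false (X ω))⁻¹ * (π false (X ω) * (ν (X ω) - ν' (X ω)))
        + (1 + g true (X ω) * (g false (X ω))⁻¹) * μ' (X ω) - (g false (X ω))⁻¹ * ν' (X ω)) P ∧
      ∫ ω, Scens X O (fun ω' => if O ω' then Y1 ω' else (if D ω' then Y1 ω' else Y0 ω'))
          μ' ν' π' g ω ∂P =
      ∫ ω, ((1 + g true (X ω) * (g false (X ω))⁻¹) * (π' true (X ω))⁻¹ *
          (π true (X ω) * (μT (X ω) - μ' (X ω)))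
        - (g false (X ω))⁻¹ * (π' false (X ω))⁻¹ * (π false (X ω) * (ν (X ω) - ν' (X ω)))
        + (1 + g true (X ω) * (g false (X ω))⁻¹) * μ' (X ω) - (g false (X ω))⁻¹ * ν' (X ω)) ∂P := by
    intro μ' ν' π' m1 m2 m3 i1 i2 hb
    obtain ⟨a1, a2, a3⟩ := aux_aipw (B := (1 + 1 / c) * (1 / c)) hm (mW.mul (m3 true).inv₀)
      (fun ω => by
        simp only [Pi.mul_apply, Pi.inv_apply]
        rw [abs_mul]
        exact mul_le_mul (bW _) (binv _ (hb _ _)) (abs_nonneg _) (by positivity))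
      iOY (ii true) (ib true) m1 i1 (hπ true) hZ1
    obtain ⟨b1, b2, b3⟩ := aux_aipw (B := (1 / c) * (1 / c)) hm (mV.mul (m3 false).inv₀)
      (fun ω => by
        simp only [Pi.mul_apply, Pi.inv_apply]
        rw [abs_mul]
        exact mul_le_mul (bV _) (binv _ (hb _ _)) (abs_nonneg _) (by positivity))
      iYt (ii false) (ib false) m2 i2 (hπ false) hν
    simp only [Pi.mul_apply, Pi.inv_apply] at a1 a2 a3 b1 b2 b3
    have c1 : Integrable (fun ω => (1 + g true (X ω) * (g false (X ω))⁻¹) * μ' (X ω)) P :=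
      i1.bdd_mul (c := 1 + 1 / c) (mW.mono hm) (Filter.Eventually.of_forall fun ω => bW _)
    have d1 : Integrable (fun ω => (g false (X ω))⁻¹ * ν' (X ω)) P :=
      i2.bdd_mul (c := 1 / c) (mV.mono hm) (Filter.Eventually.of_forall fun ω => bV _)
    refine ⟨((a2.sub b2).add c1).sub d1, ?_⟩
    rw [aux_four a2 b2 c1 d1, ← a3, ← b3, ← aux_four a1 b1 c1 d1]
    refine integral_congr_ae (Filter.Eventually.of_forall fun ω => ?_)
    have e1 := (pg false (X ω)).ne'
    have e2 := (hc.trans (hb true (X ω))).ne'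
    have e3 := (hc.trans (hb false (X ω))).ne'
    cases h : O ω
    · simp only [Scens, h]
      simp
      field_simp
      ring
    · simp only [Scens, h]
      simp
      field_simp
      ring
  obtain ⟨i1, e1⟩ := core μhat νhat πhat (meas _ hμhat) (meas _ hνhat) (fun o => meas _ (hπhat o))
    iμh iνh (fun o x => (hπhatb o x).1)
  obtain ⟨i2, e2⟩ := core μT ν π mμ mν mπ iμ iν (fun o x => (hπb o x).1)
  rw [e1, e2, ← integral_sub i1 i2]
  have iu2 : ∀ o, Integrable (fun ω => (πhat o (X ω) - π o (X ω)) ^ 2) P := by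
    intro o
    refine Integrable.of_bound (C := 1) ((((meas _ (hπhat o)).sub (mπ o)).mono hm).pow 2)
      (Filter.Eventually.of_forall fun ω => ?_)
    have := hπhatb o (X ω)
    have := hπb o (X ω)
    simp only [Set.mem_Ioo] at *
    rw [Real.norm_eq_abs, abs_of_nonneg (sq_nonneg _)]
    rw [sq_le_one_iff_abs_le_one, abs_le]
    constructor <;> linarith
  have mu : ∀ o, AEStronglyMeasurable (fun ω => πhat o (X ω) - π o (X ω)) P := fun o =>
    ((meas _ (hπhat o)).sub (mπ o)).mono hm
  have mv1 : AEStronglyMeasurable (fun ω => μhat (X ω) - μT (X ω)) P :=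
    ((meas _ hμhat).sub mμ).mono hm
  have mv2 : AEStronglyMeasurable (fun ω => νhat (X ω) - ν (X ω)) P :=
    ((meas _ hνhat).sub mν).mono hm
  have bk1 : ∀ ω, |(1 + g true (X ω) * (g false (X ω))⁻¹) * (πhat true (X ω))⁻¹|
      ≤ (1 + 1 / c) / c := by
    intro ω
    rw [abs_mul, div_eq_mul_one_div]
    exact mul_le_mul (bW _) (binv _ (hπhatb _ _).1) (abs_nonneg _) (by positivity)
  have bk2 : ∀ ω, |(g false (X ω))⁻¹ * (πhat false (X ω))⁻¹| ≤ 1 / c ^ 2 := by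
    intro ω
    rw [abs_mul, show 1 / c ^ 2 = (1 / c) * (1 / c) by field_simp]
    exact mul_le_mul (bV _) (binv _ (hπhatb _ _).1) (abs_nonneg _) (by positivity)
  have cs1 := aux_cs bk1 (by positivity) (mu true) mv1 (iu2 true) hL1
  have cs2 := aux_cs bk2 (by positivity) (mu false) mv2 (iu2 false) hL2
  have iuv1 : Integrable (fun ω => (1 + g true (X ω) * (g false (X ω))⁻¹) * (πhat true (X ω))⁻¹ *
      ((πhat true (X ω) - π true (X ω)) * (μhat (X ω) - μT (X ω)))) P := by
    refine (((memLp_two_iff_integrable_sq (mu true)).2 (iu2 true)).integrable_mul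
      ((memLp_two_iff_integrable_sq mv1).2 hL1)).bdd_mul (c := (1 + 1 / c) / c)
      ((mW.mul (meas _ (hπhat true)).inv₀).mono hm) (Filter.Eventually.of_forall bk1)
  have iuv2 : Integrable (fun ω => (g false (X ω))⁻¹ * (πhat false (X ω))⁻¹ *
      ((πhat false (X ω) - π false (X ω)) * (νhat (X ω) - ν (X ω)))) P := by
    refine (((memLp_two_iff_integrable_sq (mu false)).2 (iu2 false)).integrable_mul
      ((memLp_two_iff_integrable_sq mv2).2 hL2)).bdd_mul (c := 1 / c ^ 2)
      ((mV.mul (meas _ (hπhat false)).inv₀).mono hm) (Filter.Eventually.of_forall bk2)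
  rw [integral_congr_ae (g := fun ω => (1 + g true (X ω) * (g false (X ω))⁻¹) *
      (πhat true (X ω))⁻¹ * ((πhat true (X ω) - π true (X ω)) * (μhat (X ω) - μT (X ω))) -
      (g false (X ω))⁻¹ * (πhat false (X ω))⁻¹ *
      ((πhat false (X ω) - π false (X ω)) * (νhat (X ω) - ν (X ω)))), integral_sub iuv1 iuv2]
  · refine (abs_sub _ _).trans ?_
    have n1 : 0 ≤ (1 + 1 / c) / c := by positivity
    have n2 : 0 ≤ 1 / c ^ 2 := by positivity
    have n3 := mul_nonneg n2 (mul_nonneg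
      (Real.sqrt_nonneg (∫ ω, (πhat true (X ω) - π true (X ω))^2 ∂P))
      (Real.sqrt_nonneg (∫ ω, (μhat (X ω) - μT (X ω))^2 ∂P)))
    have n4 := mul_nonneg n1 (mul_nonneg
      (Real.sqrt_nonneg (∫ ω, (πhat false (X ω) - π false (X ω))^2 ∂P))
      (Real.sqrt_nonneg (∫ ω, (νhat (X ω) - ν (X ω))^2 ∂P)))
    linarith
  · refine Filter.Eventually.of_forall fun ω => ?_
    have e1 := (pg false (X ω)).ne'
    have e2 := (pπh true (X ω)).ne'
    have e3 := (pπh false (X ω)).ne'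
    simp only [sub_self, mul_zero]
    field_simp
    ring
end

section
/- Double robustness of the censoring estimating function: if g is correct, then E[S_cens(X,O,Y; μ, ν, π̄, g)] = τ whenever either (i) π̄ = π (true observation probability, with arbitrary μ, ν such that the expression is integrable), or (ii) μ = μ_T and ν = ν₀ (true outcome regressions, with arbitrary π̄ bounded in (c,1−c)). -/
open MeasureTheory ProbabilityTheory

lemma cens_condExp_mul {Ω : Type*} {m : MeasurableSpace Ω}
    {mΩ : MeasurableSpace Ω} [StandardBorelSpace Ω] (hm : m ≤ mΩ) (P : Measure Ω) [IsProbabilityMeasure P]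
    (f h : Ω → ℝ) (hf : Measurable f) (hh : Measurable h) (hfi : Integrable f P)
    (hhi : Integrable h P) (hfh : Integrable (fun ω => f ω * h ω) P)
    (hind : CondIndepFun m hm f h P) :
    P[(fun ω => f ω * h ω) | m] =ᵐ[P] fun ω => (P[f | m]) ω * (P[h | m]) ω := by
  have h1 := (condIndepFun_iff_map_prod_eq_prod_map_map hf hh).1 hind
  have h1 := ae_of_ae_trim hm h1
  filter_upwards [h1, condExp_ae_eq_integral_condExpKernel hm hfi,
    condExp_ae_eq_integral_condExpKernel hm hhi,
    condExp_ae_eq_integral_condExpKernel hm hfh] with ω e1 e2 e3 e4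
  rw [e2, e3, e4]
  refine IndepFun.integral_fun_mul_eq_mul_integral ?_ hf.aestronglyMeasurable
    hh.aestronglyMeasurable
  rw [indepFun_iff_map_prod_eq_prod_map_map hf.aemeasurable hh.aemeasurable]
  rw [Kernel.map_apply _ (hf.prodMk hh), Kernel.prod_apply, Kernel.map_apply _ hf,
    Kernel.map_apply _ hh] at e1
  exact e1

/-- Integral of a pull-out: `E[a W] = E[a E[W|m]]`. -/
lemma cens_integral_pull {Ω : Type*} {m : MeasurableSpace Ω}
    {mΩ : MeasurableSpace Ω} (hm : m ≤ mΩ) (P : Measure Ω) [IsProbabilityMeasure P]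
    (a W V : Ω → ℝ) (ha : AEStronglyMeasurable[m] a P) (hW : Integrable W P)
    (haW : Integrable (fun ω => a ω * W ω) P) (hV : P[W | m] =ᵐ[P] V) :
    ∫ ω, a ω * W ω ∂P = ∫ ω, a ω * V ω ∂P := by
  rw [← integral_condExp hm (f := fun ω => a ω * W ω)]
  apply integral_congr_ae
  filter_upwards [condExp_mul_of_aestronglyMeasurable_left ha haW hW, hV] with ω e1 e2
  rw [← e2]; exact e1

lemma cens_aesm_inv {Ω : Type*} {m : MeasurableSpace Ω}
    {mΩ : MeasurableSpace Ω} {P : Measure Ω} {f : Ω → ℝ} (hf : AEStronglyMeasurable[m] f P) :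
    AEStronglyMeasurable[m] (fun ω => (f ω)⁻¹) P := by
  obtain ⟨f', hf', e⟩ := hf
  refine ⟨fun ω => (f' ω)⁻¹, hf'.measurable.inv.stronglyMeasurable, ?_⟩
  filter_upwards [e] with ω h
  rw [h]

lemma cens_bound {c x y : ℝ} (hc : 0 < c) (hx : c < x) (hy : c < y) :
    ‖x⁻¹ * y⁻¹‖ ≤ c⁻¹ * c⁻¹ := by
  have hx0 : 0 < x := hc.trans hx
  have hy0 : 0 < y := hc.trans hy
  rw [Real.norm_of_nonneg (by positivity)]
  gcongr

lemma cens_integral_split {Ω : Type*} {mΩ : MeasurableSpace Ω} {P : Measure Ω} {a b d : Ω → ℝ}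
    (ha : Integrable a P) (hb : Integrable b P) (hd : Integrable d P) :
    ∫ ω, (a ω - b ω + d ω) ∂P = ∫ ω, a ω ∂P - ∫ ω, b ω ∂P + ∫ ω, d ω ∂P := by
  rw [← integral_sub ha hb]
  exact integral_add (ha.sub hb) hd

theorem cens_aux
    {Ω 𝒳 : Type*} {m : MeasurableSpace Ω} [mΩ : MeasurableSpace Ω] [StandardBorelSpace Ω]
    [m𝒳 : MeasurableSpace 𝒳]
    (P : Measure Ω) [IsProbabilityMeasure P]
    (X : Ω → 𝒳) (hm : m ≤ mΩ) (hXm : Measurable[m] X)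
    (O D : Ω → Bool) (hO : Measurable O) (hD : Measurable D)
    (Y1 Y0 : Ω → ℝ) (hY1m : Measurable Y1) (hY0m : Measurable Y0)
    (hY1 : Integrable Y1 P) (hY0 : Integrable Y0 P)
    -- unconfoundedness: (Y(1),Y(0)) ⊥ (O,D) | X
    (hunconf : CondIndepFun m hm
      (fun ω => (Y1 ω, Y0 ω)) (fun ω => (O ω, D ω)) P)
    (π : Bool → 𝒳 → ℝ) (g : Bool → 𝒳 → ℝ) (μT μC ν : 𝒳 → ℝ)
    -- π(o|X) = P(O = o | X)
    (hπ : ∀ o : Bool,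
      P[(fun ω => if O ω = o then (1:ℝ) else 0) | m]
      =ᵐ[P] fun ω => π o (X ω))
    -- g(d|X) = P(D = d | X, O = 0): E[1[O=0]·1[D=d]|X] = g(d|X)·π(0|X)
    (hg : ∀ d : Bool,
      P[(fun ω => (if O ω then (0:ℝ) else 1) * (if D ω = d then (1:ℝ) else 0))
        | m]
      =ᵐ[P] fun ω => g d (X ω) * π false (X ω))
    -- μ_T(X) = E[Y(1)|X], μ_C(X) = E[Y(0)|X]
    (hμT : P[Y1 | m] =ᵐ[P] fun ω => μT (X ω))
    (hμC : P[Y0 | m] =ᵐ[P] fun ω => μC (X ω))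
    -- ν(X) = E[Ỹ | X, O = 0]: E[1[O=0]·Ỹ|X] = ν(X)·π(0|X)
    (hν : P[(fun ω => (if O ω then (0:ℝ) else 1) * (if D ω then Y1 ω else Y0 ω))
        | m]
      =ᵐ[P] fun ω => ν (X ω) * π false (X ω))
    -- common support
    (c : ℝ) (hc : 0 < c)
    (hπc : ∀ (o : Bool) (x : 𝒳), c < π o x)
    (hgc : ∀ (d : Bool) (x : 𝒳), c < g d x)
    -- π, g bounded away from 1 as well
    (hπc1 : ∀ (o : Bool) (x : 𝒳), π o x < 1 - c) (hgc1 : ∀ (d : Bool) (x : 𝒳), g d x < 1 - c) :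
    -- (i) correct observation probability, arbitrary outcome models
    ((∀ μ ν' : 𝒳 → ℝ, Measurable μ → Measurable ν' →
        Integrable (Scens X O (fun ω => if O ω then Y1 ω else (if D ω then Y1 ω else Y0 ω))
          μ ν' π g) P →
        ∫ ω, Scens X O (fun ω' => if O ω' then Y1 ω' else (if D ω' then Y1 ω' else Y0 ω'))
            μ ν' π g ω ∂P
          = ∫ ω, (Y1 ω - Y0 ω) ∂P))
    -- (ii) correct outcome regressions, arbitrary observation-probability model
    ∧ (∀ πbar : Bool → 𝒳 → ℝ, (∀ d, Measurable (πbar d)) →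
        (∀ (d : Bool) (x : 𝒳), πbar d x ∈ Set.Ioo c (1 - c)) →
        Integrable (Scens X O (fun ω => if O ω then Y1 ω else (if D ω then Y1 ω else Y0 ω))
          μT ν πbar g) P →
        ∫ ω, Scens X O (fun ω' => if O ω' then Y1 ω' else (if D ω' then Y1 ω' else Y0 ω'))
            μT ν πbar g ω ∂P
          = ∫ ω, (Y1 ω - Y0 ω) ∂P) := by
  have hI : ∀ (A : Ω → Bool), Measurable A → ∀ b, Measurable (fun ω => if A ω = b then (1:ℝ) else 0) :=
    fun A hA b => Measurable.ite (hA (measurableSet_singleton b)) measurable_const measurable_const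
  set I1 : Ω → ℝ := fun ω => if O ω = true then (1:ℝ) else 0 with hI1
  set I0 : Ω → ℝ := fun ω => if O ω = true then (0:ℝ) else 1 with hI0
  have mI1 : Measurable I1 := hI O hO true
  have mI0 : Measurable I0 :=
    Measurable.ite (hO (measurableSet_singleton true)) measurable_const measurable_const
  have bI1 : ∀ ω, ‖I1 ω‖ ≤ 1 := fun ω => by simp only [hI1]; split_ifs <;> simp
  have bI0 : ∀ ω, ‖I0 ω‖ ≤ 1 := fun ω => by simp only [hI0]; split_ifs <;> simp
  have iI1 : Integrable I1 P :=
    Integrable.of_bound mI1.aestronglyMeasurable 1 (Filter.Eventually.of_forall bI1)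
  have iI0 : Integrable I0 P :=
    Integrable.of_bound mI0.aestronglyMeasurable 1 (Filter.Eventually.of_forall bI0)
  have eI0 : (fun ω => if O ω = false then (1:ℝ) else 0) = I0 := by
    funext ω; simp only [hI0]; cases O ω <;> simp
  have cI1 : P[I1 | m] =ᵐ[P] fun ω => π true (X ω) := hπ true
  have cI0 : P[I0 | m] =ᵐ[P] fun ω => π false (X ω) := by
    have := hπ false
    rwa [eI0] at this
  -- J d = 1[O=0] 1[D=d]
  have mJ : ∀ d, Measurable (fun ω => I0 ω * (if D ω = d then (1:ℝ) else 0)) :=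
    fun d => mI0.mul (hI D hD d)
  have bJ : ∀ d ω, ‖I0 ω * (if D ω = d then (1:ℝ) else 0)‖ ≤ 1 := fun d ω => by
    simp only [hI0]; split_ifs <;> simp
  have iJ : ∀ d, Integrable (fun ω => I0 ω * (if D ω = d then (1:ℝ) else 0)) P := fun d =>
    Integrable.of_bound (mJ d).aestronglyMeasurable 1 (Filter.Eventually.of_forall (bJ d))
  -- positivity
  have pπ : ∀ o x, 0 < π o x := fun o x => hc.trans (hπc o x)
  have pg : ∀ d x, 0 < g d x := fun d x => hc.trans (hgc d x)
  -- measurability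
  have sπ : ∀ o, AEStronglyMeasurable[m] (fun ω => π o (X ω)) P := fun o =>
    (stronglyMeasurable_condExp.aestronglyMeasurable).congr (hπ o)
  have sg : ∀ d, AEStronglyMeasurable[m] (fun ω => g d (X ω)) P := fun d => by
    have h1 : AEStronglyMeasurable[m] (fun ω => g d (X ω) * π false (X ω)) P :=
      (stronglyMeasurable_condExp.aestronglyMeasurable).congr (hg d)
    refine (h1.mul (cens_aesm_inv (sπ false))).congr (Filter.Eventually.of_forall fun ω => ?_)
    have := (pπ false (X ω)).ne'
    simp only [Pi.mul_apply]
    field_simp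
  have sμT : AEStronglyMeasurable[m] (fun ω => μT (X ω)) P :=
    (stronglyMeasurable_condExp.aestronglyMeasurable).congr hμT
  have sν : AEStronglyMeasurable[m] (fun ω => ν (X ω)) P := by
    have h1 : AEStronglyMeasurable[m] (fun ω => ν (X ω) * π false (X ω)) P :=
      (stronglyMeasurable_condExp.aestronglyMeasurable).congr hν
    refine (h1.mul (cens_aesm_inv (sπ false))).congr (Filter.Eventually.of_forall fun ω => ?_)
    have := (pπ false (X ω)).ne'
    simp only [Pi.mul_apply]
    field_simp
  -- sums to one
  have sumπ : ∀ᵐ ω ∂P, π true (X ω) + π false (X ω) = 1 := by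
    have h1 := condExp_add (m := m) iI1 iI0
    have h2 : I1 + I0 = fun _ => (1:ℝ) := by
      funext ω; simp only [hI1, hI0, Pi.add_apply]; split_ifs <;> simp
    rw [h2, condExp_const hm] at h1
    filter_upwards [h1, cI1, cI0] with ω e1 e2 e3
    rw [← e2, ← e3]; exact e1.symm
  have sumg : ∀ᵐ ω ∂P, g true (X ω) + g false (X ω) = 1 := by
    have h1 := condExp_add (m := m) (iJ true) (iJ false)
    have h2 : (fun ω => I0 ω * (if D ω = true then (1:ℝ) else 0)) +
        (fun ω => I0 ω * (if D ω = false then (1:ℝ) else 0)) = I0 := by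
      funext ω; simp only [Pi.add_apply]; cases D ω <;> simp
    rw [h2] at h1
    filter_upwards [h1, cI0, hg true, hg false] with ω e1 e2 e3 e4
    rw [Pi.add_apply, e2, e3, e4] at e1
    have := pπ false (X ω)
    have : π false (X ω) * (g true (X ω) + g false (X ω) - 1) = 0 := by linarith
    rcases mul_eq_zero.1 this with h | h <;> linarith
  -- conditional independence consequences
  have iW1 : Integrable (fun ω => I1 ω * Y1 ω) P :=
    hY1.bdd_mul mI1.aestronglyMeasurable (Filter.Eventually.of_forall bI1)
  have mBB : ∀ F : Bool × Bool → ℝ, Measurable F := fun F => measurable_of_countable F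
  have cW1 : P[(fun ω => I1 ω * Y1 ω) | m] =ᵐ[P] fun ω => π true (X ω) * μT (X ω) := by
    have hind : CondIndepFun m hm I1 Y1 P :=
      (hunconf.comp measurable_fst (mBB fun p => if p.1 = true then (1:ℝ) else 0)).symm
    filter_upwards [cens_condExp_mul hm P I1 Y1 mI1 hY1m iI1 hY1 iW1 hind, cI1, hμT]
      with ω e1 e2 e3
    rw [e1, e2, e3]
  have iJY1 : Integrable (fun ω => I0 ω * (if D ω = true then (1:ℝ) else 0) * Y1 ω) P :=
    hY1.bdd_mul (mJ true).aestronglyMeasurable (Filter.Eventually.of_forall (bJ true))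
  have iJY0 : Integrable (fun ω => I0 ω * (if D ω = false then (1:ℝ) else 0) * Y0 ω) P :=
    hY0.bdd_mul (mJ false).aestronglyMeasurable (Filter.Eventually.of_forall (bJ false))
  have cJY1 : P[(fun ω => I0 ω * (if D ω = true then (1:ℝ) else 0) * Y1 ω) | m] =ᵐ[P]
      fun ω => g true (X ω) * π false (X ω) * μT (X ω) := by
    have hind : CondIndepFun m hm (fun ω => I0 ω * (if D ω = true then (1:ℝ) else 0)) Y1 P :=
      (hunconf.comp measurable_fst (mBB fun p => (if p.1 = true then (0:ℝ) else 1) *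
        (if p.2 = true then (1:ℝ) else 0))).symm
    filter_upwards [cens_condExp_mul hm P _ Y1 (mJ true) hY1m (iJ true) hY1 iJY1 hind, hg true, hμT]
      with ω e1 e2 e3
    rw [e1, e2, e3]
  have cJY0 : P[(fun ω => I0 ω * (if D ω = false then (1:ℝ) else 0) * Y0 ω) | m] =ᵐ[P]
      fun ω => g false (X ω) * π false (X ω) * μC (X ω) := by
    have hind : CondIndepFun m hm (fun ω => I0 ω * (if D ω = false then (1:ℝ) else 0)) Y0 P :=
      (hunconf.comp measurable_snd (mBB fun p => (if p.1 = true then (0:ℝ) else 1) *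
        (if p.2 = false then (1:ℝ) else 0))).symm
    filter_upwards [cens_condExp_mul hm P _ Y0 (mJ false) hY0m (iJ false) hY0 iJY0 hind,
      hg false, hμC] with ω e1 e2 e3
    rw [e1, e2, e3]
  have eW0 : (fun ω => I0 ω * (if D ω = true then (1:ℝ) else 0) * Y1 ω) +
      (fun ω => I0 ω * (if D ω = false then (1:ℝ) else 0) * Y0 ω) =
      fun ω => I0 ω * (if D ω = true then Y1 ω else Y0 ω) := by
    funext ω; simp only [Pi.add_apply]; cases D ω <;> simp
  have iW0 : Integrable (fun ω => I0 ω * (if D ω = true then Y1 ω else Y0 ω)) P := by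
    rw [← eW0]; exact iJY1.add iJY0
  have eν : ∀ᵐ ω ∂P, ν (X ω) = g true (X ω) * μT (X ω) + g false (X ω) * μC (X ω) := by
    have h1 := condExp_add (m := m) iJY1 iJY0
    rw [eW0] at h1
    filter_upwards [h1, cJY1, cJY0, hν] with ω e1 e2 e3 e4
    rw [e4, Pi.add_apply, e2, e3] at e1
    have := pπ false (X ω)
    apply mul_right_cancel₀ this.ne'
    rw [e1]; ring
  have iμT : Integrable (fun ω => μT (X ω)) P := integrable_condExp.congr hμT
  have iμC : Integrable (fun ω => μC (X ω)) P := integrable_condExp.congr hμC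
  have iπ : ∀ o, Integrable (fun ω => π o (X ω)) P := fun o => integrable_condExp.congr (hπ o)
  have ig : ∀ d, ∀ f : Ω → ℝ, Integrable f P → Integrable (fun ω => g d (X ω) * f ω) P :=
    fun d f hf => hf.bdd_mul ((sg d).mono hm) (c := 1) (Filter.Eventually.of_forall fun ω => by
      rw [Real.norm_of_nonneg (pg d _).le]; linarith [hgc1 d (X ω)])
  have iν : Integrable (fun ω => ν (X ω)) P :=
    ((ig true _ iμT).add (ig false _ iμC)).congr (by
      filter_upwards [eν] with ω e
      rw [e]; rfl)
  have hτ : ∫ ω, (Y1 ω - Y0 ω) ∂P = ∫ ω, (μT (X ω) - μC (X ω)) ∂P := by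
    rw [integral_sub hY1 hY0, integral_sub iμT iμC, ← integral_condExp hm (f := Y1),
      ← integral_condExp hm (f := Y0), integral_congr_ae hμT, integral_congr_ae hμC]
  rw [hτ]
  -- weights
  have iwt : ∀ (q : Bool → 𝒳 → ℝ), (∀ o x, c < q o x) →
      (∀ o, AEStronglyMeasurable[m] (fun ω => q o (X ω)) P) → ∀ o, ∀ W : Ω → ℝ, Integrable W P →
      Integrable (fun ω => ((g false (X ω))⁻¹ * (q o (X ω))⁻¹) * W ω) P := by
    intro q hq sq o W hW
    exact hW.bdd_mul (((cens_aesm_inv (sg false)).mul (cens_aesm_inv (sq o))).mono hm)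
      (Filter.Eventually.of_forall fun ω => cens_bound hc (hgc _ _) (hq _ _))
  have swt : ∀ (q : Bool → 𝒳 → ℝ),
      (∀ o, AEStronglyMeasurable[m] (fun ω => q o (X ω)) P) → ∀ o,
      AEStronglyMeasurable[m] (fun ω => (g false (X ω))⁻¹ * (q o (X ω))⁻¹) P := by
    intro q sq o
    exact (cens_aesm_inv (sg false)).mul (cens_aesm_inv (sq o))
  constructor
  · intro μ ν' mμ mν hS
    have sμ : AEStronglyMeasurable[m] (fun ω => μ (X ω)) P :=
      (mμ.comp hXm).stronglyMeasurable.aestronglyMeasurable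
    have sν' : AEStronglyMeasurable[m] (fun ω => ν' (X ω)) P :=
      (mν.comp hXm).stronglyMeasurable.aestronglyMeasurable
    set k : Ω → ℝ := fun ω => (μ (X ω) * (π true (X ω))⁻¹ + ν' (X ω) * (π false (X ω))⁻¹)
      * (g false (X ω))⁻¹ with hk
    have sk : AEStronglyMeasurable[m] k P :=
      ((sμ.mul (cens_aesm_inv (sπ true))).add (sν'.mul (cens_aesm_inv (sπ false)))).mul
        (cens_aesm_inv (sg false))
    have i1 := iwt π hπc sπ true _ iW1
    have i0 := iwt π hπc sπ false _ iW0
    have eS : Scens X O (fun ω => if O ω then Y1 ω else (if D ω then Y1 ω else Y0 ω)) μ ν' π g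
        =ᵐ[P] fun ω => (((g false (X ω))⁻¹ * (π true (X ω))⁻¹) * (I1 ω * Y1 ω)
          - ((g false (X ω))⁻¹ * (π false (X ω))⁻¹) * (I0 ω * (if D ω = true then Y1 ω else Y0 ω)))
          + k ω * (π true (X ω) - I1 ω) := by
      filter_upwards [sumπ, sumg] with ω e1 e2
      have h1 := (pπ true (X ω)).ne'
      have h2 := (pπ false (X ω)).ne'
      have h3 := (pg false (X ω)).ne'
      have e1' : π true (X ω) = 1 - π false (X ω) := by linarith
      have e2' : g true (X ω) = 1 - g false (X ω) := by linarith
      simp only [Scens, hk, hI1, hI0]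
      rw [e1'] at h1
      rw [e2', e1']
      generalize (if D ω = true then Y1 ω else Y0 ω) = y
      cases O ω <;> simp <;> field_simp <;> ring
    have i2 : Integrable (fun ω => k ω * (π true (X ω) - I1 ω)) P := by
      refine ((hS.congr eS).sub (i1.sub i0)).congr (Filter.Eventually.of_forall fun ω => ?_)
      simp only [Pi.sub_apply]; ring
    have c2 : P[(fun ω => π true (X ω) - I1 ω) | m] =ᵐ[P] fun _ => 0 := by
      filter_upwards [condExp_sub (iπ true) iI1 m, cI1,
        condExp_of_aestronglyMeasurable' hm (sπ true) (iπ true)] with ω e1 e2 e3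
      rw [Pi.sub_apply, e2, e3, sub_self] at e1
      exact e1
    have k2 : Integrable (fun ω => π true (X ω) - I1 ω) P := (iπ true).sub iI1
    rw [integral_congr_ae eS, cens_integral_split i1 i0 i2,
      cens_integral_pull hm P _ _ _ (swt π sπ true) iW1 i1 cW1,
      cens_integral_pull hm P _ _ _ (swt π sπ false) iW0 i0 hν,
      cens_integral_pull hm P _ _ _ sk k2 i2 c2]
    simp only [mul_zero, integral_zero, add_zero]
    rw [← integral_sub (iwt π hπc sπ true _ (integrable_condExp.congr cW1))
      (iwt π hπc sπ false _ (integrable_condExp.congr hν))]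
    apply integral_congr_ae
    filter_upwards [sumg, eν] with ω e2 e3
    have h1 := (pπ true (X ω)).ne'
    have h2 := (pπ false (X ω)).ne'
    have h3 := (pg false (X ω)).ne'
    have e2' : g true (X ω) = 1 - g false (X ω) := by linarith
    simp only [e3, e2']
    field_simp
    ring
  · intro q mq hq _
    have sq : ∀ o, AEStronglyMeasurable[m] (fun ω => q o (X ω)) P := fun o =>
      ((mq o).comp hXm).stronglyMeasurable.aestronglyMeasurable
    have hqc : ∀ o x, c < q o x := fun o x => (hq o x).1
    have j1 : Integrable (fun ω => μT (X ω) * I1 ω) P :=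
      iμT.mul_bdd mI1.aestronglyMeasurable (Filter.Eventually.of_forall bI1)
    have j0 : Integrable (fun ω => ν (X ω) * I0 ω) P :=
      iν.mul_bdd mI0.aestronglyMeasurable (Filter.Eventually.of_forall bI0)
    have c1 : P[(fun ω => I1 ω * Y1 ω - μT (X ω) * I1 ω) | m] =ᵐ[P] fun _ => 0 := by
      filter_upwards [condExp_sub iW1 j1 m, cW1, cI1,
        condExp_mul_of_aestronglyMeasurable_left sμT j1 iI1] with ω e1 e2 e3 e4
      have e4' : (P[(fun ω => μT (X ω) * I1 ω) | m]) ω = μT (X ω) * (P[I1 | m]) ω := e4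
      rw [Pi.sub_apply, e2, e4', e3] at e1
      refine Eq.trans e1 ?_
      ring
    have c0 : P[(fun ω => I0 ω * (if D ω = true then Y1 ω else Y0 ω) - ν (X ω) * I0 ω) | m]
        =ᵐ[P] fun _ => 0 := by
      filter_upwards [condExp_sub iW0 j0 m, hν, cI0,
        condExp_mul_of_aestronglyMeasurable_left sν j0 iI0] with ω e1 e2 e3 e4
      have e4' : (P[(fun ω => ν (X ω) * I0 ω) | m]) ω = ν (X ω) * (P[I0 | m]) ω := e4
      rw [Pi.sub_apply, e2, e4', e3] at e1
      refine Eq.trans e1 ?_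
      ring
    have i1 := iwt q hqc sq true _ (iW1.sub j1)
    have i0 := iwt q hqc sq false _ (iW0.sub j0)
    have eS : Scens X O (fun ω => if O ω then Y1 ω else (if D ω then Y1 ω else Y0 ω)) μT ν q g
        =ᵐ[P] fun ω => (((g false (X ω))⁻¹ * (q true (X ω))⁻¹) * (I1 ω * Y1 ω - μT (X ω) * I1 ω)
          - ((g false (X ω))⁻¹ * (q false (X ω))⁻¹) *
            (I0 ω * (if D ω = true then Y1 ω else Y0 ω) - ν (X ω) * I0 ω))
          + (μT (X ω) - μC (X ω)) := by
      filter_upwards [sumg, eν] with ω e2 e3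
      have h1 := (hc.trans (hqc true (X ω))).ne'
      have h2 := (hc.trans (hqc false (X ω))).ne'
      have h3 := (pg false (X ω)).ne'
      have e2' : g true (X ω) = 1 - g false (X ω) := by linarith
      simp only [Scens, hI1, hI0]
      rw [e3, e2']
      generalize (if D ω = true then Y1 ω else Y0 ω) = y
      cases O ω <;> simp <;> field_simp <;> ring
    have i1' : Integrable (fun ω => ((g false (X ω))⁻¹ * (q true (X ω))⁻¹) *
      (I1 ω * Y1 ω - μT (X ω) * I1 ω)) P := i1
    have i0' : Integrable (fun ω => ((g false (X ω))⁻¹ * (q false (X ω))⁻¹) *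
      (I0 ω * (if D ω = true then Y1 ω else Y0 ω) - ν (X ω) * I0 ω)) P := i0
    have iC : Integrable (fun ω => μT (X ω) - μC (X ω)) P := iμT.sub iμC
    have k1 : Integrable (fun ω => I1 ω * Y1 ω - μT (X ω) * I1 ω) P := iW1.sub j1
    have k0 : Integrable (fun ω => I0 ω * (if D ω = true then Y1 ω else Y0 ω) - ν (X ω) * I0 ω) P :=
      iW0.sub j0
    rw [integral_congr_ae eS, cens_integral_split i1' i0' iC,
      cens_integral_pull hm P _ _ _ (swt q sq true) k1 i1' c1,
      cens_integral_pull hm P _ _ _ (swt q sq false) k0 i0' c0]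
    simp only [mul_zero, integral_zero, sub_zero, zero_add]

/-- Double robustness of the censoring estimating function: with the true `g`, the estimating
function has mean `τ = E[Y(1)−Y(0)]` if either (i) the observation probability `π` is correct
(arbitrary integrable outcome models `μ, ν`), or (ii) the outcome regressions `μ_T, ν₀` are
correct (arbitrary `π̄` bounded in `(c, 1−c)`). -/
theorem censoring_double_robustness
    {Ω 𝒳 : Type*} [MeasurableSpace Ω] [StandardBorelSpace Ω]
    [m𝒳 : MeasurableSpace 𝒳]
    (P : Measure Ω) [IsProbabilityMeasure P]
    (X : Ω → 𝒳) (hX : Measurable X)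
    (O D : Ω → Bool) (hO : Measurable O) (hD : Measurable D)
    (Y1 Y0 : Ω → ℝ) (hY1m : Measurable Y1) (hY0m : Measurable Y0)
    (hY1 : Integrable Y1 P) (hY0 : Integrable Y0 P)
    -- unconfoundedness: (Y(1),Y(0)) ⊥ (O,D) | X
    (hunconf : CondIndepFun (MeasurableSpace.comap X m𝒳) hX.comap_le
      (fun ω => (Y1 ω, Y0 ω)) (fun ω => (O ω, D ω)) P)
    (π : Bool → 𝒳 → ℝ) (g : Bool → 𝒳 → ℝ) (μT μC ν : 𝒳 → ℝ)
    -- π(o|X) = P(O = o | X)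
    (hπ : ∀ o : Bool,
      P[(fun ω => if O ω = o then (1:ℝ) else 0) | MeasurableSpace.comap X m𝒳]
      =ᵐ[P] fun ω => π o (X ω))
    -- g(d|X) = P(D = d | X, O = 0): E[1[O=0]·1[D=d]|X] = g(d|X)·π(0|X)
    (hg : ∀ d : Bool,
      P[(fun ω => (if O ω then (0:ℝ) else 1) * (if D ω = d then (1:ℝ) else 0))
        | MeasurableSpace.comap X m𝒳]
      =ᵐ[P] fun ω => g d (X ω) * π false (X ω))
    -- μ_T(X) = E[Y(1)|X], μ_C(X) = E[Y(0)|X]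
    (hμT : P[Y1 | MeasurableSpace.comap X m𝒳] =ᵐ[P] fun ω => μT (X ω))
    (hμC : P[Y0 | MeasurableSpace.comap X m𝒳] =ᵐ[P] fun ω => μC (X ω))
    -- ν(X) = E[Ỹ | X, O = 0]: E[1[O=0]·Ỹ|X] = ν(X)·π(0|X)
    (hν : P[(fun ω => (if O ω then (0:ℝ) else 1) * (if D ω then Y1 ω else Y0 ω))
        | MeasurableSpace.comap X m𝒳]
      =ᵐ[P] fun ω => ν (X ω) * π false (X ω))
    -- common support
    (c : ℝ) (hc : 0 < c)
    (hπc : ∀ (o : Bool) (x : 𝒳), c < π o x)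
    (hgc : ∀ (d : Bool) (x : 𝒳), c < g d x)
    -- π, g bounded away from 1 as well
    (hπc1 : ∀ (o : Bool) (x : 𝒳), π o x < 1 - c) (hgc1 : ∀ (d : Bool) (x : 𝒳), g d x < 1 - c) :
    -- (i) correct observation probability, arbitrary outcome models
    ((∀ μ ν' : 𝒳 → ℝ, Measurable μ → Measurable ν' →
        Integrable (Scens X O (fun ω => if O ω then Y1 ω else (if D ω then Y1 ω else Y0 ω))
          μ ν' π g) P →
        ∫ ω, Scens X O (fun ω' => if O ω' then Y1 ω' else (if D ω' then Y1 ω' else Y0 ω'))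
            μ ν' π g ω ∂P
          = ∫ ω, (Y1 ω - Y0 ω) ∂P))
    -- (ii) correct outcome regressions, arbitrary observation-probability model
    ∧ (∀ πbar : Bool → 𝒳 → ℝ, (∀ d, Measurable (πbar d)) →
        (∀ (d : Bool) (x : 𝒳), πbar d x ∈ Set.Ioo c (1 - c)) →
        Integrable (Scens X O (fun ω => if O ω then Y1 ω else (if D ω then Y1 ω else Y0 ω))
          μT ν πbar g) P →
        ∫ ω, Scens X O (fun ω' => if O ω' then Y1 ω' else (if D ω' then Y1 ω' else Y0 ω'))
            μT ν πbar g ω ∂P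
          = ∫ ω, (Y1 ω - Y0 ω) ∂P) := by
  exact cens_aux P X hX.comap_le (comap_measurable X) O D hO hD Y1 Y0 hY1m hY0m hY1 hY0 hunconf
    π g μT μC ν hπ hg hμT hμC hν c hc hπc hgc hπc1 hgc1
end
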